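/- Let R be a commutative ring, Λ = R[A, A⁻¹] the Laurent polynomial ring, M a Λ-module, N = M/(A+1)·M regarded as an R-module via evaluation A ↦ −1, and π : M → N the quotient map. Suppose L₁, …, Lₙ ∈ M generate M as a Λ-module, the images π(L₁), …, π(Lₙ) are R-linearly independent in N, and M has no (A+1)-torsion (i.e., for all m ∈ M, (A+1)·m = 0 implies m = 0). Then L₁, …, Lₙ form a Λ-basis of M; in particular M is a free Λ-module of rank n. -/

import Mathlib

open LaurentPolynomial

open Polynomial in
theorem toLaurent_X_sub_C_neg_one {R : Type*} [CommRing R] :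
    toLaurent (X - Polynomial.C (-1) : R[X]) = T 1 + 1 := by
  simp

open Polynomial in
theorem toLaurent_smul_eq_divByMonic_add_eval {R M : Type*} [CommRing R] [AddCommGroup M]
    [Module (LaurentPolynomial R) M] [Module R M] [IsScalarTower R (LaurentPolynomial R) M]
    (p : R[X]) (m : M) :
    toLaurent p • m = (T 1 + 1 : LaurentPolynomial R) • toLaurent (p /ₘ (X - Polynomial.C (-1))) • m
      + p.eval (-1) • m := by
  conv_lhs => rw [← modByMonic_add_div p (X - Polynomial.C (-1)), modByMonic_X_sub_C_eq_C_eval]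
  rw [map_add, map_mul, toLaurent_X_sub_C_neg_one, add_smul, mul_smul, add_comm, toLaurent_C,
    ← smul_one_smul (LaurentPolynomial R) (p.eval (-1)) m, LaurentPolynomial.smul_eq_C_mul, mul_one]

open Polynomial in
theorem eval_neg_one_eq_zero_of_sum_toLaurent_smul_eq_zero
    {R M ι : Type*} [CommRing R] [AddCommGroup M]
    [Module (LaurentPolynomial R) M] [Module R M] [IsScalarTower R (LaurentPolynomial R) M]
    [Fintype ι] {L : ι → M} {P : Submodule (LaurentPolynomial R) M}
    (hP : ∀ m : M, (T 1 + 1 : LaurentPolynomial R) • m ∈ P)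
    (hind : LinearIndependent R (fun i => Submodule.Quotient.mk (p := P) (L i)))
    {p : ι → R[X]} (hp : ∑ i, toLaurent (p i) • L i = 0) (i : ι) : (p i).eval (-1) = 0 := by
  refine Fintype.linearIndependent_iff.mp hind (fun i => (p i).eval (-1)) ?_ i
  have hmem : ∑ i, (p i).eval (-1) • L i ∈ P := by
    rw [Finset.sum_congr rfl fun i _ => toLaurent_smul_eq_divByMonic_add_eval (p i) (L i),
      Finset.sum_add_distrib, ← Finset.smul_sum] at hp
    rw [eq_neg_of_add_eq_zero_right hp]
    exact P.neg_mem (hP _)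
  have hmk := (Submodule.Quotient.mk_eq_zero P).mpr hmem
  rw [← Submodule.mkQ_apply, map_sum] at hmk
  exact hmk

open Polynomial in
/-- Descent on the degree: a polynomial relation is divisible by `A + 1`, and the quotient is again
a relation. -/
theorem eq_zero_of_sum_toLaurent_smul_eq_zero {R M ι : Type*} [CommRing R] [AddCommGroup M]
    [Module (LaurentPolynomial R) M] [Module R M] [IsScalarTower R (LaurentPolynomial R) M]
    [Fintype ι] {L : ι → M} {P : Submodule (LaurentPolynomial R) M}
    (hP : ∀ m : M, (T 1 + 1 : LaurentPolynomial R) • m ∈ P)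
    (hind : LinearIndependent R (fun i => Submodule.Quotient.mk (p := P) (L i)))
    (htors : ∀ m : M, (T 1 + 1 : LaurentPolynomial R) • m = 0 → m = 0)
    (d : ℕ) (p : ι → R[X]) (hd : ∀ i, (p i).natDegree ≤ d)
    (hp : ∑ i, toLaurent (p i) • L i = 0) (i : ι) : p i = 0 := by
  nontriviality R
  have heval := eval_neg_one_eq_zero_of_sum_toLaurent_smul_eq_zero hP hind hp
  induction d generalizing p i with
  | zero =>
    have h := heval i
    rw [eq_C_of_natDegree_le_zero (hd i), eval_C] at h
    rw [eq_C_of_natDegree_le_zero (hd i), h, Polynomial.C_0]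
  | succ d ih =>
    have hq : ∑ i, toLaurent (p i /ₘ (X - Polynomial.C (-1))) • L i = 0 := by
      rw [Finset.sum_congr rfl fun i _ => toLaurent_smul_eq_divByMonic_add_eval (p i) (L i)] at hp
      simp_rw [heval, zero_smul, add_zero, ← Finset.smul_sum] at hp
      exact htors _ hp
    have hzero := ih (fun i => p i /ₘ (X - Polynomial.C (-1))) (fun j => by
      rw [natDegree_divByMonic _ (monic_X_sub_C _), natDegree_X_sub_C]
      exact Nat.sub_le_of_le_add (hd j)) hq i
      (eval_neg_one_eq_zero_of_sum_toLaurent_smul_eq_zero hP hind hq)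
    rw [← mul_divByMonic_eq_iff_isRoot.mpr (heval i), hzero, mul_zero]

open Polynomial in
/-- Finitely many Laurent polynomials have a common monomial denominator. -/
theorem exists_common_T_mul_eq_toLaurent {R ι : Type*} [CommRing R] [Fintype ι]
    (f : ι → LaurentPolynomial R) :
    ∃ (N : ℕ) (p : ι → R[X]), ∀ i, toLaurent (p i) = T N * f i := by
  choose k q hq using fun i => LaurentPolynomial.exists_T_pow (f i)
  refine ⟨∑ i, k i, fun i => X ^ (∑ j, k j - k i) * q i, fun i => ?_⟩
  have hle : k i ≤ ∑ j, k j := Finset.single_le_sum (fun _ _ => Nat.zero_le _) (Finset.mem_univ i)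
  rw [map_mul, hq, toLaurent_X_pow, mul_left_comm, ← T_add, ← Nat.cast_add,
    Nat.sub_add_cancel hle, mul_comm]

/-- Let `Λ = R[A,A⁻¹]`, `M` a `Λ`-module, `P = (A+1)·M`, and
`N = M ⧸ P` regarded as an `R`-module (this `R`-module structure agrees with the one
induced by the isomorphism `Λ/(A+1) ≅ R` given by evaluation at `A = -1`).
If `L₁, …, Lₙ` generate `M` over `Λ`, their images in `N` are `R`-linearly
independent, and `M` has no `(A+1)`-torsion, then the `Lᵢ` form a `Λ`-basis of `M`;
in particular `M` is a free `Λ`-module of rank `n`. -/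
theorem laurent_basis_of_no_A_plus_one_torsion
    (R : Type*) [CommRing R] (M : Type*) [AddCommGroup M]
    [Module (LaurentPolynomial R) M] [Module R M]
    [IsScalarTower R (LaurentPolynomial R) M]
    (n : ℕ) (L : Fin n → M)
    (P : Submodule (LaurentPolynomial R) M)
    (hP : P = Ideal.span {(T 1 + 1 : LaurentPolynomial R)} •
      (⊤ : Submodule (LaurentPolynomial R) M))
    (hgen : Submodule.span (LaurentPolynomial R) (Set.range L) = ⊤)
    (hind : LinearIndependent R (fun i => Submodule.Quotient.mk (p := P) (L i)))
    (htors : ∀ m : M, (T 1 + 1 : LaurentPolynomial R) • m = 0 → m = 0) :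
    LinearIndependent (LaurentPolynomial R) L ∧
      ∃ b : Module.Basis (Fin n) (LaurentPolynomial R) M, ∀ i, b i = L i := by
  have hP' : ∀ m : M, (T 1 + 1 : LaurentPolynomial R) • m ∈ P := fun m => by
    rw [hP]
    exact Submodule.smul_mem_smul (Ideal.mem_span_singleton_self _) Submodule.mem_top
  have hli : LinearIndependent (LaurentPolynomial R) L := by
    refine Fintype.linearIndependent_iff.mpr fun f hf i => ?_
    obtain ⟨N, p, hp⟩ := exists_common_T_mul_eq_toLaurent f
    have hsum : ∑ i, Polynomial.toLaurent (p i) • L i = 0 := by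
      simp_rw [hp, mul_smul, ← Finset.smul_sum, hf, smul_zero]
    have hzero := eq_zero_of_sum_toLaurent_smul_eq_zero hP' hind htors _ p
      (fun j => Finset.le_sup (f := fun j => (p j).natDegree) (Finset.mem_univ j)) hsum i
    have h := hp i
    rw [hzero, map_zero] at h
    exact ((isUnit_T (N : ℤ)).mul_right_eq_zero).mp h.symm
  exact ⟨hli, Module.Basis.mk hli hgen.ge, fun i => Module.Basis.mk_apply hli hgen.ge i⟩
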